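/- arXiv:math/0309343 — 8 statements merged into one kernel-verified Lean document; each statement's English description precedes it below -/
import Mathlib

section
/- Let k ≥ 1 be a natural number and for i = 1,…,k let g_i, h_i : [0,1] → ℂ be measurable functions. Define f(x,y) = Σ_{i=1}^k g_i(x)·h_i(y) and let Z = {(x,y) ∈ [0,1]×[0,1] : f(x,y) = 0}. Let I, J ⊆ [0,1] be intervals of positive length and let δ be a real number with 0 < δ < 1/k. If λ²((I×J) ∩ Z) > (1 − δ²)·λ(I)·λ(J), then there exist measurable sets E ⊆ I and F ⊆ J such that E×F ⊆ Z and λ(E)·λ(F) ≥ (1 − kδ)²·λ(I)·λ(J). -/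
open MeasureTheory Set

open Submodule Module in
/-- Finitely many vectors `G (x i)`, with `x i ∈ s`, at most as many as the dimension, suffice to
test whether a linear form vanishes on the image of `s` under `G`. -/
theorem exists_fin_forall_dual_eq_zero {K V α : Type*} [Field K] [AddCommGroup V] [Module K V]
    [FiniteDimensional K V] (G : α → V) (s : Set α) :
    ∃ (m : ℕ) (x : Fin m → α), m ≤ finrank K V ∧ (∀ i, x i ∈ s) ∧
      ∀ φ : V →ₗ[K] K, (∀ i, φ (G (x i)) = 0) → ∀ a ∈ s, φ (G a) = 0 := by
  obtain ⟨v, hv, hspan, -⟩ := exists_fun_fin_finrank_span_eq K (G '' s)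
  choose x hxs hx using hv
  refine ⟨_, x, finrank_le _, hxs, fun φ hφ a ha ↦ ?_⟩
  have hle : span K (range v) ≤ LinearMap.ker φ := by
    rw [span_le]
    rintro _ ⟨i, rfl⟩
    simpa [← hx i] using hφ i
  rw [hspan] at hle
  exact hle (subset_span ⟨a, ha, rfl⟩)

section

variable {α β : Type*} [MeasurableSpace α] [MeasurableSpace β]

theorem mul_measureReal_setOf_le_measureReal_prodMk_preimage_le (μ : Measure α) (ν : Measure β)
    [IsFiniteMeasure μ] [IsFiniteMeasure ν] {S : Set (α × β)} (hS : MeasurableSet S) (ε : ℝ) :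
    ε * μ.real {x | ε ≤ ν.real (Prod.mk x ⁻¹' S)} ≤ (μ.prod ν).real S := by
  refine (mul_meas_ge_le_integral_of_nonneg (.of_forall fun _ ↦ measureReal_nonneg)
    (Measure.integrable_measure_prodMk_left hS (measure_ne_top _ _)) ε).trans_eq ?_
  simp_rw [measureReal_def]
  rw [integral_toReal (measurable_measure_prodMk_left hS).aemeasurable
    (.of_forall fun _ ↦ measure_lt_top _ _), Measure.prod_apply hS]

/-- If `S` has relative measure at most `δ²`, then the points whose section of `S` has relative
measure less than `δ` have relative measure at least `1 - δ`. -/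
theorem le_measureReal_setOf_measureReal_prodMk_preimage_lt (μ : Measure α) (ν : Measure β)
    [IsFiniteMeasure μ] [IsFiniteMeasure ν] {S : Set (α × β)} (hS : MeasurableSet S) {δ : ℝ}
    (hδ : 0 < δ) (hν : 0 < ν.real univ)
    (h : (μ.prod ν).real S ≤ δ ^ 2 * μ.real univ * ν.real univ) :
    (1 - δ) * μ.real univ ≤ μ.real {x | ν.real (Prod.mk x ⁻¹' S) < δ * ν.real univ} := by
  have hm : MeasurableSet {x | ν.real (Prod.mk x ⁻¹' S) < δ * ν.real univ} :=
    measurableSet_lt (measurable_measure_prodMk_left hS).ennreal_toReal measurable_const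
  have hmarkov := (mul_measureReal_setOf_le_measureReal_prodMk_preimage_le μ ν hS
    (δ * ν.real univ)).trans h
  have hcompl : {x | δ * ν.real univ ≤ ν.real (Prod.mk x ⁻¹' S)} =
      {x | ν.real (Prod.mk x ⁻¹' S) < δ * ν.real univ}ᶜ := by
    ext; simp
  rw [hcompl, measureReal_compl hm] at hmarkov
  have := le_of_mul_le_mul_left
    (hmarkov.trans_eq (by ring : _ = δ * ν.real univ * (δ * μ.real univ))) (mul_pos hδ hν)
  linarith

theorem le_measureReal_iInter_compl (ν : Measure β) [IsFiniteMeasure ν] {m : ℕ}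
    {A : Fin m → Set β} (hA : ∀ i, MeasurableSet (A i)) {c : ℝ} (h : ∀ i, ν.real (A i) ≤ c) :
    ν.real univ - m * c ≤ ν.real (⋂ i, (A i)ᶜ) := by
  rw [← compl_iUnion, measureReal_compl (.iUnion hA)]
  have : ∑ i, ν.real (A i) ≤ m * c := by
    simpa using Finset.sum_le_sum fun i (_ : i ∈ Finset.univ) ↦ h i
  linarith [measureReal_iUnion_fintype_le (μ := ν) A]

end

/-- The Claim in Appendix I: if the zero set `Z` of `f(x,y) = Σ_{i<k} gᵢ(x)·hᵢ(y)` nearly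
fills the rectangle `I × J` (up to proportion `δ²`), then `Z` contains a measurable
rectangle `E × F ⊆ I × J` of proportion at least `(1 - kδ)²`. -/
theorem stmt0 (k : ℕ) (hk : 1 ≤ k) (g h : Fin k → ℝ → ℂ)
    (hg : ∀ i, Measurable (g i)) (hh : ∀ i, Measurable (h i))
    (Z : Set (ℝ × ℝ))
    (hZ : Z = {p : ℝ × ℝ | (p.1 ∈ Icc (0:ℝ) 1 ∧ p.2 ∈ Icc (0:ℝ) 1) ∧
      ∑ i : Fin k, g i p.1 * h i p.2 = 0})
    (I J : Set ℝ) (hIint : I.OrdConnected) (hJint : J.OrdConnected)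
    (hI1 : I ⊆ Icc (0:ℝ) 1) (hJ1 : J ⊆ Icc (0:ℝ) 1)
    (hIpos : 0 < volume I) (hJpos : 0 < volume J)
    (δ : ℝ) (hδ0 : 0 < δ) (hδk : δ < 1 / (k : ℝ))
    (hbig : ENNReal.ofReal (1 - δ ^ 2) * volume I * volume J < volume ((I ×ˢ J) ∩ Z)) :
    ∃ E F : Set ℝ, MeasurableSet E ∧ MeasurableSet F ∧ E ⊆ I ∧ F ⊆ J ∧
      E ×ˢ F ⊆ Z ∧
      ENNReal.ofReal ((1 - (k : ℝ) * δ) ^ 2) * volume I * volume J ≤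
        volume E * volume F := by
  have hIm : MeasurableSet I := hIint.measurableSet
  have hJm : MeasurableSet J := hJint.measurableSet
  have hItop : volume I ≠ ⊤ := measure_ne_top_of_subset hI1 (by simp)
  have hJtop : volume J ≠ ⊤ := measure_ne_top_of_subset hJ1 (by simp)
  set μ : Measure ℝ := volume.restrict I with hμ
  set ν : Measure ℝ := volume.restrict J with hν
  have : IsFiniteMeasure μ := isFiniteMeasure_restrict.2 hItop
  have : IsFiniteMeasure ν := isFiniteMeasure_restrict.2 hJtop
  have hμuniv : μ.real univ = volume.real I := by simp [hμ]
  have hνuniv : ν.real univ = volume.real J := by simp [hν]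
  have hk1 : (1 : ℝ) ≤ k := by exact_mod_cast hk
  have hkδ : k * δ < 1 := by
    rwa [lt_div_iff₀ (by linarith), mul_comm] at hδk
  have hδle : δ ≤ k * δ := le_mul_of_one_le_left hδ0.le hk1
  have hIr : 0 < volume.real I := ENNReal.toReal_pos hIpos.ne' hItop
  have hJr : 0 < volume.real J := ENNReal.toReal_pos hJpos.ne' hJtop
  set S : Set (ℝ × ℝ) := {p | ∑ i, g i p.1 * h i p.2 = 0}ᶜ with hSdef
  have hS : MeasurableSet S :=
    (measurableSet_eq_fun (by fun_prop) measurable_const).compl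
  have hprod : (I ×ˢ J) ∩ Z = Sᶜ ∩ I ×ˢ J := by
    ext p
    simp only [hZ, hSdef, mem_inter_iff, mem_prod, mem_ofPred_eq, compl_compl]
    exact ⟨fun hp ↦ ⟨hp.2.2, hp.1⟩, fun hp ↦ ⟨hp.2, ⟨hI1 hp.2.1, hJ1 hp.2.2⟩, hp.1⟩⟩
  have hsmall : (μ.prod ν).real S ≤ δ ^ 2 * μ.real univ * ν.real univ := by
    have huniv : (μ.prod ν).real univ = μ.real univ * ν.real univ := by
      rw [← univ_prod_univ, measureReal_prod_prod]
    have hvol : (μ.prod ν) Sᶜ = volume ((I ×ˢ J) ∩ Z) := by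
      rw [hprod, hμ, hν, Measure.prod_restrict, Measure.restrict_apply hS.compl,
        Measure.volume_eq_prod]
    have hlt := ENNReal.toReal_strict_mono (measure_ne_top _ _) (hvol ▸ hbig)
    rw [ENNReal.toReal_mul, ENNReal.toReal_mul,
      ENNReal.toReal_ofReal (by nlinarith)] at hlt
    simp only [← measureReal_def] at hlt
    rw [measureReal_compl hS, huniv, ← hμuniv, ← hνuniv] at hlt
    linarith
  have hgood := le_measureReal_setOf_measureReal_prodMk_preimage_lt μ ν hS hδ0
    (hνuniv ▸ hJr) hsmall
  set E₀ : Set ℝ := {x | ν.real (Prod.mk x ⁻¹' S) < δ * ν.real univ}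
  have hE₀m : MeasurableSet E₀ :=
    measurableSet_lt (measurable_measure_prodMk_left hS).ennreal_toReal measurable_const
  obtain ⟨m, x, hmk, hxE, hx⟩ :=
    exists_fin_forall_dual_eq_zero (K := ℂ) (fun (x : ℝ) (i : Fin k) ↦ g i x) E₀
  rw [Module.finrank_fin_fun] at hmk
  have hAm (i : Fin m) : MeasurableSet (Prod.mk (x i) ⁻¹' S) := measurable_prodMk_left hS
  have hF := le_measureReal_iInter_compl ν hAm fun i ↦ (hxE i).le
  set F₀ : Set ℝ := ⋂ i, (Prod.mk (x i) ⁻¹' S)ᶜ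
  have hF₀m : MeasurableSet F₀ := .iInter fun i ↦ (hAm i).compl
  refine ⟨E₀ ∩ I, F₀ ∩ J, hE₀m.inter hIm, hF₀m.inter hJm, inter_subset_right,
    inter_subset_right, ?_, ?_⟩
  · rintro ⟨a, b⟩ ⟨⟨haE, haI⟩, hbF, hbJ⟩
    rw [hZ]
    refine ⟨⟨hI1 haI, hJ1 hbJ⟩, ?_⟩
    have hφ := hx (∑ i, h i b • LinearMap.proj i) (fun j ↦ ?_) a haE
    · simpa [mul_comm] using hφ
    · have := mem_iInter.1 hbF j
      simpa [hSdef, mul_comm] using this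
  · rw [← Measure.restrict_apply hE₀m, ← Measure.restrict_apply hF₀m, ← hμ, ← hν,
      ← ofReal_measureReal hItop, ← ofReal_measureReal hJtop, ← ofReal_measureReal,
      ← ofReal_measureReal, ← ENNReal.ofReal_mul (sq_nonneg _),
      ← ENNReal.ofReal_mul (by positivity), ← ENNReal.ofReal_mul measureReal_nonneg]
    refine ENNReal.ofReal_le_ofReal ?_
    rw [hμuniv] at hgood
    rw [hνuniv] at hF
    have hmk' : (m : ℝ) ≤ k := by exact_mod_cast hmk
    have hE₁ : (1 - k * δ) * volume.real I ≤ μ.real E₀ :=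
      (mul_le_mul_of_nonneg_right (by linarith) hIr.le).trans hgood
    have hF₁ : (1 - k * δ) * volume.real J ≤ ν.real F₀ := by
      have := mul_le_mul_of_nonneg_right hmk' (mul_pos hδ0 hJr).le
      linarith
    calc (1 - k * δ) ^ 2 * volume.real I * volume.real J
        = ((1 - k * δ) * volume.real I) * ((1 - k * δ) * volume.real J) := by ring
      _ ≤ μ.real E₀ * ν.real F₀ :=
        mul_le_mul hE₁ hF₁ (mul_nonneg (by linarith) hJr.le) measureReal_nonneg
end

section
/- Let k ≥ 1 be a natural number and for i = 1,…,k let g_i, h_i : [0,1] → ℂ be measurable functions. Define f(x,y) = Σ_{i=1}^k g_i(x)·h_i(y) and let Z = {(x,y) ∈ [0,1]×[0,1] : f(x,y) = 0}. Then there exists a countable family of pairs of measurable sets (E_m, F_m), m ∈ ℕ, with E_m × F_m ⊆ Z for every m, such that λ²(Z \ ⋃_m (E_m × F_m)) = 0. -/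
open MeasureTheory Set

/-- For a σ-finite Borel measure on a finite-dimensional space there are countably many subspaces
such that, for every subspace `W` of dimension at most `d`, almost every point of `W` lies in one
of them that is contained in `W`. -/
theorem exists_countable_submodules_ae_cover_of_finrank_le {𝕜 E : Type*}
    [NontriviallyNormedField 𝕜] [CompleteSpace 𝕜] [NormedAddCommGroup E] [NormedSpace 𝕜 E]
    [FiniteDimensional 𝕜 E] [MeasurableSpace E] [OpensMeasurableSpace E]
    (ν : Measure E) [SigmaFinite ν] (d : ℕ) :
    ∃ S : Set (Submodule 𝕜 E), S.Countable ∧ ∀ W : Submodule 𝕜 E, Module.finrank 𝕜 W ≤ d →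
      ν ((W : Set E) \ ⋃ V ∈ {V ∈ S | V ≤ W}, (V : Set E)) = 0 := by
  induction d with
  | zero =>
    refine ⟨{⊥}, countable_singleton _, fun W hW => ?_⟩
    obtain rfl : W = ⊥ := Submodule.finrank_eq_zero.mp (Nat.le_zero.mp hW)
    simp
  | succ d ih =>
    obtain ⟨S, hS, hcover⟩ := ih
    have hmeas (W : Submodule 𝕜 E) : MeasurableSet (W : Set E) :=
      W.closed_of_finiteDimensional.measurableSet
    let A (W : Submodule 𝕜 E) : Set E := (W : Set E) \ ⋃ V ∈ {V ∈ S | V ≤ W}, (V : Set E)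
    have hA (W) : MeasurableSet (A W) :=
      (hmeas W).diff (.biUnion (hS.mono (sep_subset _ _)) fun V _ => hmeas V)
    have hcount : {W : {W : Submodule 𝕜 E // Module.finrank 𝕜 W = d + 1} |
        0 < ν (A W)}.Countable := by
      refine Measure.countable_meas_pos_of_disjoint_iUnion₀
        (fun W => (hA W).nullMeasurableSet) ?_
      rintro ⟨W₁, h₁⟩ ⟨W₂, h₂⟩ hne
      refine measure_mono_null ?_ (hcover (W₁ ⊓ W₂) ?_)
      · rintro v ⟨⟨hv₁, hv⟩, hv₂, -⟩
        refine ⟨⟨hv₁, hv₂⟩, fun hv' => hv ?_⟩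
        simp only [mem_iUnion, mem_ofPred_eq, exists_prop] at hv' ⊢
        obtain ⟨V, ⟨hVS, hV⟩, hvV⟩ := hv'
        exact ⟨V, ⟨hVS, hV.trans inf_le_left⟩, hvV⟩
      · rw [← Nat.lt_succ_iff, Nat.succ_eq_add_one, ← h₁]
        refine Submodule.finrank_lt_finrank_of_lt (inf_le_left.lt_of_ne fun h => hne ?_)
        exact Subtype.ext (Submodule.eq_of_le_of_finrank_eq (inf_eq_left.mp h) (h₁.trans h₂.symm))
    refine ⟨S ∪ _, hS.union (hcount.image Subtype.val), fun W hW => ?_⟩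
    by_cases hmem : Module.finrank 𝕜 W = d + 1 ∧ 0 < ν (A W)
    · refine measure_mono_null (fun v hv => (hv.2 ?_).elim) (measure_empty (μ := ν))
      simp only [mem_iUnion, mem_ofPred_eq, exists_prop]
      exact ⟨W, ⟨.inr ⟨⟨W, hmem.1⟩, hmem.2, rfl⟩, le_rfl⟩, hv.1⟩
    · have hnull : ν (A W) = 0 := by
        rcases hW.lt_or_eq with h | h
        · exact hcover W (Nat.lt_succ_iff.mp h)
        · simpa [h] using hmem
      refine measure_mono_null (sdiff_subset_sdiff_right ?_) hnull
      exact biUnion_subset_biUnion_left fun V hV => ⟨.inl hV.1, hV.2⟩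

/-- Appendix I lemma (measure-theoretic content): the zero set `Z` of
`f(x,y) = Σ_{i<k} gᵢ(x)·hᵢ(y)` on `[0,1]²` is, up to a Lebesgue-null set, a countable
union of measurable rectangles contained in `Z`. -/
theorem stmt1 (k : ℕ) (hk : 1 ≤ k) (g h : Fin k → ℝ → ℂ)
    (hg : ∀ i, Measurable (g i)) (hh : ∀ i, Measurable (h i))
    (Z : Set (ℝ × ℝ))
    (hZ : Z = {p : ℝ × ℝ | (p.1 ∈ Icc (0:ℝ) 1 ∧ p.2 ∈ Icc (0:ℝ) 1) ∧
      ∑ i : Fin k, g i p.1 * h i p.2 = 0}) :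
    ∃ E F : ℕ → Set ℝ,
      (∀ m, MeasurableSet (E m)) ∧ (∀ m, MeasurableSet (F m)) ∧
      (∀ m, E m ×ˢ F m ⊆ Z) ∧
      volume (Z \ ⋃ m, E m ×ˢ F m) = 0 := by
  let G : ℝ → Fin k → ℂ := fun x i => g i x
  let H : ℝ → Fin k → ℂ := fun y i => h i y
  have hG : Measurable G := measurable_pi_lambda _ hg
  have hH : Measurable H := measurable_pi_lambda _ hh
  obtain ⟨S, hS, hcover⟩ := exists_countable_submodules_ae_cover_of_finrank_le (𝕜 := ℂ)
    ((volume.restrict (Icc (0 : ℝ) 1)).map H) (Module.finrank ℂ (Fin k → ℂ))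
  obtain ⟨V, hV⟩ := countable_iff_exists_subset_range.mp hS
  let E (m : ℕ) : Set ℝ := Icc 0 1 ∩ G ⁻¹' {u | ∀ v ∈ V m, u ⬝ᵥ v = 0}
  let F (m : ℕ) : Set ℝ := Icc 0 1 ∩ H ⁻¹' (V m)
  have hE (m) : MeasurableSet (E m) := by
    refine measurableSet_Icc.inter (hG (IsClosed.measurableSet ?_))
    simp only [ofPred_forall]
    exact isClosed_biInter fun v _ => isClosed_eq (by fun_prop) continuous_const
  have hF (m) : MeasurableSet (F m) :=
    measurableSet_Icc.inter (hH (V m).closed_of_finiteDimensional.measurableSet)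
  have hZmeas : MeasurableSet Z := by
    rw [hZ]
    refine ((measurableSet_Icc.preimage measurable_fst).inter
      (measurableSet_Icc.preimage measurable_snd)).inter
      (measurableSet_eq_fun ?_ measurable_const)
    exact Finset.measurable_sum _ fun i _ =>
      ((hg i).comp measurable_fst).mul ((hh i).comp measurable_snd)
  refine ⟨E, F, hE, hF, ?_, ?_⟩
  · rintro m ⟨x, y⟩ ⟨⟨hx, hxV⟩, hy, hyV⟩
    rw [hZ]
    exact ⟨⟨hx, hy⟩, hxV _ hyV⟩
  rw [Measure.volume_eq_prod,
    Measure.measure_prod_null (hZmeas.diff (.iUnion fun m => (hE m).prod (hF m)))]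
  refine Filter.Eventually.of_forall fun x => ?_
  let W : Submodule ℂ (Fin k → ℂ) :=
    LinearMap.ker (∑ i, G x i • (LinearMap.proj i : (Fin k → ℂ) →ₗ[ℂ] ℂ))
  have hW (v) : v ∈ W ↔ G x ⬝ᵥ v = 0 := by simp [W, dotProduct]
  have hnull := hcover W W.finrank_le
  replace hnull := le_antisymm ((Measure.le_map_apply hH.aemeasurable _).trans_eq hnull) zero_le
  rw [Measure.restrict_apply' measurableSet_Icc] at hnull
  refine measure_mono_null ?_ hnull
  rintro y ⟨hxy, hnot⟩
  rw [hZ] at hxy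
  obtain ⟨⟨hx, hy⟩, hzero⟩ := hxy
  refine ⟨⟨(hW _).mpr hzero, fun hmem => hnot ?_⟩, hy⟩
  simp only [mem_iUnion, mem_ofPred_eq, exists_prop] at hmem
  obtain ⟨U, ⟨hUS, hUW⟩, hyU⟩ := hmem
  obtain ⟨m, rfl⟩ := hV hUS
  exact mem_iUnion.mpr ⟨m, ⟨hx, fun v hv => (hW v).mp (hUW hv)⟩, hy, hyU⟩
end

section
/- Let R be an associative unital algebra over a commutative ring k, let I ⊆ R be a two-sided ideal, let S ⊆ R be a subset, and let A be the unital subalgebra of R generated by S. Then the k-submodule of R spanned by the commutators {[t, s] : t ∈ I, s ∈ S} coincides with the k-submodule spanned by {[t, a] : t ∈ I, a ∈ A}. -/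
/-- The `k`-span of the commutators of elements of a two-sided ideal `I` with elements of `S`
contains every commutator of an element of `I` with an element of the subalgebra generated
by `S`. -/
theorem TwoSidedIdeal.commutator_mem_span_of_mem_adjoin {k R : Type*} [CommRing k] [Ring R]
    [Algebra k R] (I : TwoSidedIdeal R) (S : Set R) {t a : R} (ht : t ∈ I)
    (ha : a ∈ Algebra.adjoin k S) :
    t * a - a * t ∈ Submodule.span k {x : R | ∃ t ∈ I, ∃ s ∈ S, x = t * s - s * t} := by
  induction ha using Algebra.adjoin_induction generalizing t with
  | mem s hs => exact Submodule.subset_span ⟨t, ht, s, hs, rfl⟩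
  | algebraMap r => simp [Algebra.commutes r t]
  | add x y _ _ hx hy =>
    have h : t * (x + y) - (x + y) * t = (t * x - x * t) + (t * y - y * t) := by noncomm_ring
    exact h ▸ Submodule.add_mem _ (hx ht) (hy ht)
  | mul x y _ _ hx hy =>
    have h : t * (x * y) - x * y * t = (t * x * y - y * (t * x)) + (y * t * x - x * (y * t)) := by
      noncomm_ring
    exact h ▸ Submodule.add_mem _ (hy (I.mul_mem_right t x ht)) (hx (I.mul_mem_left y t ht))

/-- For a two-sided ideal `I` of an associative unital `k`-algebra `R` and a subset
`S ⊆ R` generating the unital subalgebra `A`, the `k`-span of `{[t,s] : t ∈ I, s ∈ S}`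
equals the `k`-span of `{[t,a] : t ∈ I, a ∈ A}`. -/
theorem stmt4 {k R : Type*} [CommRing k] [Ring R] [Algebra k R]
    (I : TwoSidedIdeal R) (S : Set R) :
    Submodule.span k {x : R | ∃ t ∈ I, ∃ s ∈ S, x = t * s - s * t} =
      Submodule.span k {x : R | ∃ t ∈ I, ∃ a ∈ Algebra.adjoin k S, x = t * a - a * t} := by
  apply le_antisymm
  · apply Submodule.span_mono
    rintro x ⟨t, ht, s, hs, rfl⟩
    exact ⟨t, ht, s, Algebra.subset_adjoin hs, rfl⟩
  · rw [Submodule.span_le]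
    rintro x ⟨t, ht, a, ha, rfl⟩
    exact I.commutator_mem_span_of_mem_adjoin S ht ha
end

section
/- Let H be a complex Hilbert space whose inner product ⟨·,·⟩ is conjugate-linear in the first variable, let Ω ∈ H, and let J : H → H be a conjugate-linear map satisfying J∘J = id, ⟨Jξ, Jη⟩ = ⟨η, ξ⟩ for all ξ, η ∈ H, and JΩ = Ω. Let Q and Z be bounded linear operators on H such that J(ZΩ) = Z*Ω. Then ⟨Ω, QZ*Ω⟩ − ⟨Ω, Z*QΩ⟩ = ⟨ZΩ, (J∘Q*∘J)(Ω) − Q(Ω)⟩. -/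
open scoped InnerProductSpace

/-- Lemma relating commutators and the Tomita conjugation: for a conjugate-linear
involution `J` with `⟪Jξ, Jη⟫ = ⟪η, ξ⟫` and `JΩ = Ω`, and bounded operators `Q`, `Z`
with `J(ZΩ) = Z*Ω`, one has `⟪Ω, QZ*Ω⟫ - ⟪Ω, Z*QΩ⟫ = ⟪ZΩ, (JQ*J - Q)Ω⟫`. -/
theorem stmt5 {H : Type*} [NormedAddCommGroup H] [InnerProductSpace ℂ H]
    [CompleteSpace H] (Ω : H) (J : H →ₗ⋆[ℂ] H)
    (hJinv : ∀ ξ : H, J (J ξ) = ξ)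
    (hJinner : ∀ ξ η : H, ⟪J ξ, J η⟫_ℂ = ⟪η, ξ⟫_ℂ)
    (hJΩ : J Ω = Ω)
    (Q Z : H →L[ℂ] H)
    (hZ : J (Z Ω) = ContinuousLinearMap.adjoint Z Ω) :
    ⟪Ω, Q (ContinuousLinearMap.adjoint Z Ω)⟫_ℂ
        - ⟪Ω, ContinuousLinearMap.adjoint Z (Q Ω)⟫_ℂ =
      ⟪Z Ω, J (ContinuousLinearMap.adjoint Q (J Ω)) - Q Ω⟫_ℂ := by
  have hJ : ⟪Z Ω, J (ContinuousLinearMap.adjoint Q Ω)⟫_ℂ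
      = ⟪Ω, Q (ContinuousLinearMap.adjoint Z Ω)⟫_ℂ := by
    rw [← hJinv (Z Ω), hJinner, hZ, ContinuousLinearMap.adjoint_inner_left]
  rw [inner_sub_right, hJΩ, hJ, ContinuousLinearMap.adjoint_inner_right]
end

section
/- Let H be a complex Hilbert space and let X be a bounded self-adjoint operator on H that has no eigenvalues (i.e., there is no nonzero v ∈ H and scalar μ with Xv = μv). If T is a compact operator on H with T∘X = X∘T, then T = 0. -/
open Module.End in
/-- A linear endomorphism commuting with an endomorphism having a nonzero finite-dimensional
eigenspace has an eigenvector. -/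
theorem exists_eigenvector_of_commute_of_finiteDimensional_eigenspace {K V : Type*} [Field K]
    [IsAlgClosed K] [AddCommGroup V] [Module K V] {A S : Module.End K V} (h : Commute S A)
    {μ : K} (hμ : HasEigenvalue S μ) [FiniteDimensional K (eigenspace S μ)] :
    ∃ (c : K) (v : V), v ≠ 0 ∧ A v = c • v := by
  have hmaps : ∀ v ∈ eigenspace S μ, A v ∈ eigenspace S μ :=
    mapsTo_genEigenspace_of_comm h μ 1
  have : Nontrivial (eigenspace S μ) := Submodule.nontrivial_iff_ne_bot.2 hμ
  obtain ⟨c, hc⟩ := exists_eigenvalue (A.restrict hmaps)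
  obtain ⟨v, hv⟩ := hc.exists_hasEigenvector
  exact ⟨c, v, by simpa using hv.2, congrArg Subtype.val hv.apply_eq_smul⟩

/-- A compact operator commuting with a bounded self-adjoint operator having no
eigenvalues must be zero. -/
theorem stmt6 {H : Type*} [NormedAddCommGroup H] [InnerProductSpace ℂ H]
    [CompleteSpace H] (X T : H →L[ℂ] H)
    (hX : IsSelfAdjoint X)
    (hXeig : ∀ (μ : ℂ) (v : H), X v = μ • v → v = 0)
    (hT : IsCompactOperator T)
    (hcomm : T ∘L X = X ∘L T) :
    T = 0 := by
  have hTX : Commute T X := hcomm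
  have hSX : Commute (star T * T) X := by
    refine Commute.mul_left ?_ hTX
    simpa [hX.star_eq] using hTX.star_star
  have hScpt : IsCompactOperator (star T * T : H →L[ℂ] H) := hT.clm_comp (star T)
  have hSsymm := (IsSelfAdjoint.star_mul_self T).isSymmetric
  have hSX' : Commute ((star T * T : H →L[ℂ] H) : Module.End ℂ H) (X : Module.End ℂ H) :=
    congrArg ContinuousLinearMap.toLinearMap hSX
  have hS : star T * T = 0 := by
    refine (ContinuousLinearMap.eq_zero_of_forall_hasEigenvalue_eq_zero hScpt hSsymm).1 ?_
    intro μ hμ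
    by_contra hμ0
    have := ContinuousLinearMap.finite_dimensional_eigenspace hScpt μ hμ0
    obtain ⟨c, v, hv, hcv⟩ :=
      exists_eigenvector_of_commute_of_finiteDimensional_eigenspace hSX' hμ
    exact hv (hXeig c v hcv)
  exact CStarRing.star_mul_self_eq_zero_iff T |>.1 hS
end

section
/- Let H be a complex Hilbert space, let A be a unital complex *-algebra, and let π, ρ : A → B(H) be unital *-homomorphisms into the bounded operators on H whose ranges commute, i.e., π(a)∘ρ(b) = ρ(b)∘π(a) for all a, b ∈ A. Suppose ξ ∈ H satisfies π(a)ξ = ρ(a)ξ for all a ∈ A. Then the linear functional φ(a) = ⟨ξ, π(a)ξ⟩ is tracial: φ(ab) = φ(ba) for all a, b ∈ A. -/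
open scoped InnerProductSpace

/-- If `π, ρ` are unital *-homomorphisms of a unital complex *-algebra into `B(H)` with
commuting ranges, and `ξ ∈ H` satisfies `π(a)ξ = ρ(a)ξ` for all `a`, then
`φ(a) = ⟪ξ, π(a)ξ⟫` is tracial. -/
theorem stmt7 {H : Type*} [NormedAddCommGroup H] [InnerProductSpace ℂ H]
    [CompleteSpace H] {A : Type*} [Ring A] [Algebra ℂ A] [StarRing A] [StarModule ℂ A]
    (π ρ : A →⋆ₐ[ℂ] (H →L[ℂ] H))
    (hcomm : ∀ a b : A, π a ∘L ρ b = ρ b ∘L π a)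
    (ξ : H) (hξ : ∀ a : A, π a ξ = ρ a ξ) :
    ∀ a b : A, ⟪ξ, π (a * b) ξ⟫_ℂ = ⟪ξ, π (b * a) ξ⟫_ℂ := by
  intro a b
  have h : π (a * b) ξ = π (b * a) ξ := calc
    π (a * b) ξ = π a (π b ξ) := by rw [map_mul]; rfl
    _ = π a (ρ b ξ) := by rw [hξ b]
    _ = ρ b (π a ξ) := DFunLike.congr_fun (hcomm a b) ξ
    _ = ρ b (ρ a ξ) := by rw [hξ a]
    _ = ρ (b * a) ξ := by rw [map_mul]; rfl
    _ = π (b * a) ξ := (hξ (b * a)).symm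
  rw [h]
end

section
/- Let (X, 𝒜) be a measurable space, let n ≥ 1, and let F : X → M_n(ℂ) be a measurable matrix-valued function. Then there exists a countable family of measurable functions ζ_m : X → ℂⁿ, m ∈ ℕ, such that for every z ∈ X one has F(z)·ζ_m(z) = 0 for all m, and the vectors {ζ_m(z) : m ∈ ℕ} span the kernel of F(z) in ℂⁿ. -/
namespace Matrix

open Polynomial

variable {m n : Type*} [Fintype m] [Fintype n] [DecidableEq n]

/-- The quotient of the characteristic polynomial by `X ^ k`, discarding the terms of degree
less than `k`, evaluated at the matrix. -/
noncomputable def charpolyShift (H : Matrix n n ℂ) (k : ℕ) : Matrix n n ℂ :=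
  ∑ i ∈ Finset.range (Fintype.card n + 1), H.charpoly.coeff (i + k) • H ^ i

theorem pow_mul_charpolyShift (H : Matrix n n ℂ) {k : ℕ}
    (hk : ∀ i < k, H.charpoly.coeff i = 0) : H ^ k * H.charpolyShift k = 0 := by
  have hpoly : H.charpoly = X ^ k *
      ∑ i ∈ Finset.range (Fintype.card n + 1), monomial i (H.charpoly.coeff (i + k)) := by
    ext d
    rw [coeff_X_pow_mul']
    split_ifs with hd
    · simp only [finsetSum_coeff, coeff_monomial, Finset.sum_ite_eq', Finset.mem_range,
        Nat.sub_add_cancel hd]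
      split_ifs with h
      · rfl
      · refine coeff_eq_zero_of_natDegree_lt ?_
        rw [charpoly_natDegree_eq_dim]
        lia
    · exact hk d (not_le.mp hd)
  have h := aeval_self_charpoly H
  rw [hpoly] at h
  simpa [charpolyShift, aeval_monomial, Algebra.smul_def] using h

theorem charpolyShift_mulVec_of_mulVec_eq_zero {H : Matrix n n ℂ} {x : n → ℂ}
    (hx : H *ᵥ x = 0) (k : ℕ) : H.charpolyShift k *ᵥ x = H.charpoly.coeff k • x := by
  rw [charpolyShift, sum_mulVec, Finset.sum_eq_single 0]
  · rw [zero_add, pow_zero, smul_mulVec, one_mulVec]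
  · intro i _ hi
    obtain ⟨j, rfl⟩ := Nat.exists_eq_succ_of_ne_zero hi
    rw [smul_mulVec, pow_succ, ← mulVec_mulVec, hx, mulVec_zero, smul_zero]
  · simp

open ComplexOrder in
theorem mul_eq_zero_of_pow_conjTranspose_mul_self_mul_eq_zero (F : Matrix m n ℂ)
    (Q : Matrix n n ℂ) (k : ℕ) (h : (Fᴴ * F) ^ k * Q = 0) : F * Q = 0 := by
  induction k using Nat.strong_induction_on with
  | _ k ih =>
    match k with
    | 0 => simp_all
    | 1 => rwa [pow_one, conjTranspose_mul_self_mul_eq_zero] at h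
    | k + 2 =>
      refine ih (k + 1) (by lia) ?_
      have hH : (Fᴴ * F)ᴴ = Fᴴ * F := by simp
      rw [pow_succ', Matrix.mul_assoc, ← conjTranspose_mul_self_mul_eq_zero, hH,
        ← h, pow_succ', pow_succ']
      simp only [Matrix.mul_assoc]

theorem measurable_charpoly_coeff {X : Type*} [MeasurableSpace X] {H : X → Matrix n n ℂ}
    (hH : ∀ i j, Measurable fun z => H z i j) (k : ℕ) :
    Measurable fun z => (H z).charpoly.coeff k := by
  have h : ∀ z, (H z).charpoly.coeff k =
      MvPolynomial.eval (fun p : n × n => H z p.1 p.2) ((charpoly.univ ℂ n).coeff k) := by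
    intro z
    exact (charpoly.univ_coeff_eval₂Hom n (RingHom.id ℂ) (fun p => H z p.1 p.2) k).symm
  simp_rw [h]
  exact (MvPolynomial.continuous_eval _).measurable.comp
    (measurable_pi_lambda _ fun p => hH p.1 p.2)

theorem measurable_pow_apply {X : Type*} [MeasurableSpace X] {H : X → Matrix n n ℂ}
    (hH : ∀ i j, Measurable fun z => H z i j) (k : ℕ) (i j : n) :
    Measurable fun z => (H z ^ k) i j := by
  induction k generalizing i j with
  | zero => simp
  | succ k ih =>
    simp only [pow_succ, mul_apply]
    exact Finset.measurable_fun_sum _ fun l _ => (ih i l).mul (hH l j)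

theorem measurable_charpolyShift_apply {X : Type*} [MeasurableSpace X] {H : X → Matrix n n ℂ}
    (hH : ∀ i j, Measurable fun z => H z i j) (k : ℕ) (i j : n) :
    Measurable fun z => (H z).charpolyShift k i j := by
  simp only [charpolyShift, sum_apply, smul_apply, smul_eq_mul]
  exact Finset.measurable_fun_sum _ fun l _ =>
    (measurable_charpoly_coeff hH _).mul (measurable_pow_apply hH l i j)

open Classical in
/-- The `j`-th column of `(Fᴴ * F).charpolyShift k` if `X ^ k` divides the characteristic
polynomial of `Fᴴ * F`, and zero otherwise. -/
noncomputable def kernelVector (F : Matrix m n ℂ) (p : ℕ × n) : n → ℂ :=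
  if ∀ i < p.1, (Fᴴ * F).charpoly.coeff i = 0 then ((Fᴴ * F).charpolyShift p.1).col p.2 else 0

theorem mulVec_kernelVector (F : Matrix m n ℂ) (p : ℕ × n) : F *ᵥ F.kernelVector p = 0 := by
  rw [kernelVector]
  split_ifs with h
  · have hQ := mul_eq_zero_of_pow_conjTranspose_mul_self_mul_eq_zero F _ _
      (pow_mul_charpolyShift _ h)
    ext i
    exact congrFun (congrFun hQ i) p.2
  · exact mulVec_zero F

theorem span_range_kernelVector (F : Matrix m n ℂ) :
    Submodule.span ℂ (Set.range F.kernelVector) = LinearMap.ker F.mulVecLin := by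
  apply le_antisymm
  · rw [Submodule.span_le]
    rintro _ ⟨p, rfl⟩
    exact F.mulVec_kernelVector p
  · intro x hx
    have hFx : (Fᴴ * F) *ᵥ x = 0 := by
      rw [← mulVec_mulVec, show F *ᵥ x = 0 from hx, mulVec_zero]
    set k := (Fᴴ * F).charpoly.natTrailingDegree
    have hk : ∀ i < k, (Fᴴ * F).charpoly.coeff i = 0 :=
      fun i hi => coeff_eq_zero_of_lt_natTrailingDegree hi
    have hk0 : (Fᴴ * F).charpoly.coeff k ≠ 0 :=
      trailingCoeff_nonzero_iff_nonzero.mpr (charpoly_monic _).ne_zero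
    rw [← inv_smul_smul₀ hk0 x, ← charpolyShift_mulVec_of_mulVec_eq_zero hFx, mulVec_eq_sum]
    refine Submodule.smul_mem _ _ (Submodule.sum_mem _ fun j _ => ?_)
    have hj : ((Fᴴ * F).charpolyShift k)ᵀ j = F.kernelVector (k, j) := (if_pos hk).symm
    rw [hj, op_smul_eq_smul]
    exact Submodule.smul_mem _ _ (Submodule.subset_span ⟨_, rfl⟩)

theorem measurable_kernelVector {X : Type*} [MeasurableSpace X] {F : X → Matrix m n ℂ}
    (hF : ∀ i j, Measurable fun z => F z i j) (p : ℕ × n) :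
    Measurable fun z => (F z).kernelVector p := by
  have hH : ∀ i j, Measurable fun z => ((F z)ᴴ * F z) i j := fun i j => by
    simp only [mul_apply, conjTranspose_apply]
    exact Finset.measurable_fun_sum _ fun l _ => (continuous_star.measurable.comp (hF l i)).mul (hF l j)
  refine Measurable.ite ?_ (measurable_pi_lambda _ fun i =>
    measurable_charpolyShift_apply hH p.1 i p.2) measurable_const
  simp only [Set.ofPred_forall]
  exact MeasurableSet.iInter fun i => MeasurableSet.iInter fun _ =>
    measurable_charpoly_coeff hH i (measurableSet_singleton 0)

end Matrix


/-- Measurable spanning of pointwise kernels: for a measurable matrix-valued map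
`F : X → Mₙ(ℂ)` there is a countable family of measurable vector-valued maps `ζₘ`
such that at every point `z` each `ζₘ(z)` lies in the kernel of `F(z)` and together
they span it. -/
theorem stmt10 {X : Type*} [MeasurableSpace X] (n : ℕ) (hn : 1 ≤ n)
    (F : X → Matrix (Fin n) (Fin n) ℂ)
    (hF : ∀ i j : Fin n, Measurable fun z => F z i j) :
    ∃ ζ : ℕ → X → (Fin n → ℂ),
      (∀ m, Measurable (ζ m)) ∧
      (∀ (z : X) (m : ℕ), (F z).mulVec (ζ m z) = 0) ∧
      (∀ z : X, Submodule.span ℂ (Set.range fun m => ζ m z) =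
        LinearMap.ker (F z).mulVecLin) := by
  have : Nonempty (Fin n) := ⟨⟨0, hn⟩⟩
  obtain ⟨f, hf⟩ := exists_surjective_nat (ℕ × Fin n)
  refine ⟨fun m z => (F z).kernelVector (f m), fun m => Matrix.measurable_kernelVector hF _,
    fun z m => (F z).mulVec_kernelVector _, fun z => ?_⟩
  rw [← (F z).span_range_kernelVector, ← hf.range_comp]
  rfl
end

section
/- Let n ≥ 1 and let F : [0,1]×[0,1] → M_n(ℂ) be a matrix-valued function each of whose entries is a finite sum of products, F_{ij}(x,y) = Σ_l g_{ijl}(x)·h_{ijl}(y), with all g_{ijl}, h_{ijl} bounded measurable functions on [0,1]. Let K = {v ∈ L²([0,1]², ℂⁿ) : F(z)·v(z) = 0 for almost every z ∈ [0,1]²}, and let K₀ be the set of those v ∈ K each of whose n components is a finite sum of products Σ_l a_l(x)·b_l(y) with a_l, b_l bounded measurable on [0,1]. Then K₀ is dense in K with respect to the L²-norm. -/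
open MeasureTheory Set
open scoped ENNReal NNReal

/-- A function `u : ℝ² → ℂ` is *elementary* if it is a finite sum of products
`Σ_l a_l(x)·b_l(y)` with `a_l, b_l` measurable and bounded on `[0,1]`. -/
def ElemOn (u : ℝ × ℝ → ℂ) : Prop :=
  ∃ (L : ℕ) (a b : Fin L → ℝ → ℂ),
    (∀ l, Measurable (a l)) ∧ (∀ l, Measurable (b l)) ∧
    (∀ l, ∃ C : ℝ, ∀ x ∈ Icc (0:ℝ) 1, ‖a l x‖ ≤ C) ∧
    (∀ l, ∃ C : ℝ, ∀ y ∈ Icc (0:ℝ) 1, ‖b l y‖ ≤ C) ∧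
    (∀ p : ℝ × ℝ, u p = ∑ l, a l p.1 * b l p.2)


namespace ElemOn

lemma of_fintype {ι : Type*} [Fintype ι] {u : ℝ × ℝ → ℂ} (a b : ι → ℝ → ℂ)
    (ha : ∀ l, Measurable (a l)) (hb : ∀ l, Measurable (b l))
    (ha' : ∀ l, ∃ C : ℝ, ∀ x ∈ Icc (0:ℝ) 1, ‖a l x‖ ≤ C)
    (hb' : ∀ l, ∃ C : ℝ, ∀ y ∈ Icc (0:ℝ) 1, ‖b l y‖ ≤ C)
    (hu : ∀ p : ℝ × ℝ, u p = ∑ l, a l p.1 * b l p.2) : ElemOn u := by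
  let e := (Fintype.equivFin ι).symm
  refine ⟨Fintype.card ι, fun l => a (e l), fun l => b (e l), fun l => ha _, fun l => hb _,
    fun l => ha' _, fun l => hb' _, fun p => ?_⟩
  rw [hu p]
  exact (Equiv.sum_comp e fun l => a l p.1 * b l p.2).symm

lemma of_prod {f g : ℝ → ℂ} (hf : Measurable f) (hg : Measurable g)
    (hf' : ∃ C : ℝ, ∀ x ∈ Icc (0:ℝ) 1, ‖f x‖ ≤ C)
    (hg' : ∃ C : ℝ, ∀ y ∈ Icc (0:ℝ) 1, ‖g y‖ ≤ C) :
    ElemOn fun p => f p.1 * g p.2 :=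
  of_fintype (ι := Unit) (fun _ => f) (fun _ => g) (fun _ => hf) (fun _ => hg) (fun _ => hf')
    (fun _ => hg') (by simp)

lemma const (c : ℂ) : ElemOn fun _ => c := by
  simpa using of_prod (f := fun _ => c) (g := fun _ => 1) measurable_const measurable_const
    ⟨‖c‖, by simp⟩ ⟨1, by simp⟩

lemma add {u v : ℝ × ℝ → ℂ} (hu : ElemOn u) (hv : ElemOn v) : ElemOn (u + v) := by
  obtain ⟨L, a, b, ha, hb, ha', hb', hu⟩ := hu
  obtain ⟨M, c, d, hc, hd, hc', hd', hv⟩ := hv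
  refine of_fintype (ι := Fin L ⊕ Fin M) (Sum.elim a c) (Sum.elim b d) ?_ ?_ ?_ ?_ ?_
  · rintro (l | l) <;> simp [ha, hc]
  · rintro (l | l) <;> simp [hb, hd]
  · rintro (l | l)
    exacts [ha' l, hc' l]
  · rintro (l | l)
    exacts [hb' l, hd' l]
  · intro p
    simp [hu, hv]

lemma exists_bound_mul {s : Set ℝ} {f g : ℝ → ℂ} (hf : ∃ C : ℝ, ∀ x ∈ s, ‖f x‖ ≤ C)
    (hg : ∃ C : ℝ, ∀ x ∈ s, ‖g x‖ ≤ C) : ∃ C : ℝ, ∀ x ∈ s, ‖f x * g x‖ ≤ C := by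
  obtain ⟨C, hC⟩ := hf
  obtain ⟨D, hD⟩ := hg
  refine ⟨C * D, fun x hx => ?_⟩
  rw [norm_mul]
  exact mul_le_mul (hC x hx) (hD x hx) (norm_nonneg _) ((norm_nonneg _).trans (hC x hx))

lemma mul {u v : ℝ × ℝ → ℂ} (hu : ElemOn u) (hv : ElemOn v) : ElemOn (u * v) := by
  obtain ⟨L, a, b, ha, hb, ha', hb', hu⟩ := hu
  obtain ⟨M, c, d, hc, hd, hc', hd', hv⟩ := hv
  refine of_fintype (ι := Fin L × Fin M) (fun i x => a i.1 x * c i.2 x)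
    (fun i y => b i.1 y * d i.2 y) (fun i => (ha _).mul (hc _)) (fun i => (hb _).mul (hd _))
    (fun i => exists_bound_mul (ha' _) (hc' _)) (fun i => exists_bound_mul (hb' _) (hd' _)) ?_
  intro p
  rw [Pi.mul_apply, hu, hv, Finset.sum_mul_sum, Fintype.sum_prod_type]
  refine Finset.sum_congr rfl fun i _ => Finset.sum_congr rfl fun j _ => ?_
  ring

lemma star {u : ℝ × ℝ → ℂ} (hu : ElemOn u) : ElemOn (Star.star u) := by
  obtain ⟨L, a, b, ha, hb, ha', hb', hu⟩ := hu
  refine ⟨L, fun l x => Star.star (a l x), fun l y => Star.star (b l y),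
    fun l => Complex.continuous_conj.measurable.comp (ha l),
    fun l => Complex.continuous_conj.measurable.comp (hb l),
    fun l => by simpa using ha' l, fun l => by simpa using hb' l, fun p => ?_⟩
  simp [hu]

lemma measurable {u : ℝ × ℝ → ℂ} (hu : ElemOn u) : Measurable u := by
  obtain ⟨L, a, b, ha, hb, -, -, hu⟩ := hu
  rw [funext hu]
  exact Finset.measurable_sum _ fun l _ =>
    ((ha l).comp measurable_fst).mul ((hb l).comp measurable_snd)

lemma exists_bound {u : ℝ × ℝ → ℂ} (hu : ElemOn u) :
    ∃ C : ℝ, ∀ p ∈ Icc (0:ℝ) 1 ×ˢ Icc (0:ℝ) 1, ‖u p‖ ≤ C := by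
  obtain ⟨L, a, b, -, -, ha, hb, hu⟩ := hu
  choose A hA using ha
  choose B hB using hb
  refine ⟨∑ l, A l * B l, fun p hp => ?_⟩
  rw [hu p]
  refine norm_sum_le_of_le _ fun l _ => ?_
  rw [norm_mul]
  exact mul_le_mul (hA l _ hp.1) (hB l _ hp.2) (norm_nonneg _)
    ((norm_nonneg _).trans (hA l _ hp.1))

lemma indicator_prod {X Y : Set ℝ} (hX : MeasurableSet X) (hY : MeasurableSet Y) :
    ElemOn ((X ×ˢ Y).indicator 1) := by
  have key : ∀ s : Set ℝ, ∃ C : ℝ, ∀ x ∈ Icc (0:ℝ) 1, ‖s.indicator (1 : ℝ → ℂ) x‖ ≤ C :=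
    fun s => ⟨1, fun x _ => by by_cases h : x ∈ s <;> simp [h]⟩
  convert of_prod (f := X.indicator 1) (g := Y.indicator 1) (measurable_one.indicator hX)
    (measurable_one.indicator hY) (key X) (key Y) using 1
  ext p
  by_cases h1 : p.1 ∈ X <;> by_cases h2 : p.2 ∈ Y <;> simp [Set.indicator, h1, h2]

end ElemOn

/-- The algebra of elementary functions. -/
def elemAlg : Subalgebra ℂ (ℝ × ℝ → ℂ) where
  carrier := {u | ElemOn u}
  mul_mem' := ElemOn.mul
  add_mem' := ElemOn.add
  algebraMap_mem' := ElemOn.const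

/-- Evaluation of elementary functions at a point. -/
def elemEval (z : ℝ × ℝ) : elemAlg →+* ℂ :=
  (Pi.evalRingHom (fun _ : ℝ × ℝ => ℂ) z).comp elemAlg.val.toRingHom

lemma elemEval_apply (z : ℝ × ℝ) (u : elemAlg) : elemEval z u = (u : ℝ × ℝ → ℂ) z := rfl

lemma ElemOn.sum {ι : Type*} (s : Finset ι) {u : ι → ℝ × ℝ → ℂ} (hu : ∀ i ∈ s, ElemOn (u i)) :
    ElemOn (∑ i ∈ s, u i) :=
  elemAlg.sum_mem hu

/-- The restriction of Lebesgue measure to the unit interval. -/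
noncomputable abbrev unitVol : Measure ℝ := volume.restrict (Icc (0:ℝ) 1)

/-- The restriction of Lebesgue measure to the unit square. -/
noncomputable abbrev squareVol : Measure (ℝ × ℝ) :=
  volume.restrict (Icc (0:ℝ) 1 ×ˢ Icc (0:ℝ) 1)

lemma squareVol_eq_prod : squareVol = unitVol.prod unitVol := by
  rw [Measure.prod_restrict, ← Measure.volume_eq_prod]

instance isProbabilityMeasure_unitVol : IsProbabilityMeasure unitVol :=
  ⟨by simp [unitVol]⟩

instance isProbabilityMeasure_squareVol : IsProbabilityMeasure squareVol := by
  rw [squareVol_eq_prod]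
  infer_instance

/-- The continuous functions on the unit square that extend to elementary functions. -/
def elemStarAlg : StarSubalgebra ℂ C(Icc (0:ℝ) 1 ×ˢ Icc (0:ℝ) 1, ℂ) where
  carrier := {g | ∃ u, ElemOn u ∧ ∀ z, g z = u z}
  mul_mem' := by
    rintro _ _ ⟨u, hu, h⟩ ⟨u', hu', h'⟩
    exact ⟨u * u', hu.mul hu', by simp [h, h']⟩
  add_mem' := by
    rintro _ _ ⟨u, hu, h⟩ ⟨u', hu', h'⟩
    exact ⟨u + u', hu.add hu', by simp [h, h']⟩
  algebraMap_mem' c := ⟨fun _ => c, ElemOn.const c, fun _ => rfl⟩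
  star_mem' := by
    rintro _ ⟨u, hu, h⟩
    exact ⟨star u, hu.star, by simp [h]⟩

lemma elemStarAlg_separatesPoints : elemStarAlg.SeparatesPoints := by
  have hid : ∃ C : ℝ, ∀ x ∈ Icc (0:ℝ) 1, ‖(x : ℂ)‖ ≤ C :=
    ⟨1, fun x hx => by simpa [abs_of_nonneg hx.1] using hx.2⟩
  have hone : ∃ C : ℝ, ∀ x ∈ Icc (0:ℝ) 1, ‖(1 : ℂ)‖ ≤ C := ⟨1, by simp⟩
  intro p q hpq
  by_cases h : p.1.1 = q.1.1
  · refine ⟨_, ⟨⟨fun z => (z.1.2 : ℂ), by fun_prop⟩, ⟨_, ElemOn.of_prod (f := fun _ => 1)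
      (g := fun y => (y : ℂ)) measurable_const Complex.measurable_ofReal hone hid, by simp⟩, rfl⟩,
      fun h' => hpq (Subtype.ext (Prod.ext h ?_))⟩
    simpa using h'
  · refine ⟨_, ⟨⟨fun z => (z.1.1 : ℂ), by fun_prop⟩, ⟨_, ElemOn.of_prod (f := fun x => (x : ℂ))
      (g := fun _ => 1) Complex.measurable_ofReal measurable_const hid hone, by simp⟩, rfl⟩,
      fun h' => h ?_⟩
    simpa using h'

lemma exists_elemOn_norm_sub_le {f : ℝ × ℝ → ℂ} (hf : Continuous f) {ε : ℝ} (hε : 0 < ε) :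
    ∃ u, ElemOn u ∧ ∀ z ∈ Icc (0:ℝ) 1 ×ˢ Icc (0:ℝ) 1, ‖f z - u z‖ ≤ ε := by
  have : CompactSpace (Icc (0:ℝ) 1 ×ˢ Icc (0:ℝ) 1 : Set (ℝ × ℝ)) :=
    isCompact_iff_compactSpace.1 (isCompact_Icc.prod isCompact_Icc)
  have htop := ContinuousMap.starSubalgebra_topologicalClosure_eq_top_of_separatesPoints
    elemStarAlg elemStarAlg_separatesPoints
  let g : C(Icc (0:ℝ) 1 ×ˢ Icc (0:ℝ) 1, ℂ) := ⟨fun z => f z, by fun_prop⟩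
  have hg : g ∈ closure (elemStarAlg : Set C(Icc (0:ℝ) 1 ×ˢ Icc (0:ℝ) 1, ℂ)) := by
    rw [← StarSubalgebra.topologicalClosure_coe, htop]
    trivial
  obtain ⟨k, ⟨u, hu, hk⟩, hd⟩ := Metric.mem_closure_iff.1 hg ε hε
  refine ⟨u, hu, fun z hz => ?_⟩
  have := (ContinuousMap.dist_apply_le_dist (f := g) (g := k) ⟨z, hz⟩).trans hd.le
  rwa [hk, dist_eq_norm] at this

lemma exists_elemOn_eLpNorm_sub_le {f : ℝ × ℝ → ℂ} (hf : MemLp f 2 squareVol) {ε : ℝ}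
    (hε : 0 < ε) : ∃ u, ElemOn u ∧ eLpNorm (f - u) 2 squareVol ≤ ENNReal.ofReal ε := by
  obtain ⟨g, -, hfg, hg, hgL⟩ := hf.exists_hasCompactSupport_eLpNorm_sub_le (by simp)
    (ε := ENNReal.ofReal (ε / 2)) (by simpa using hε)
  obtain ⟨u, hu, hgu⟩ := exists_elemOn_norm_sub_le hg (half_pos hε)
  refine ⟨u, hu, ?_⟩
  have h2 : eLpNorm (g - u) 2 squareVol ≤ ENNReal.ofReal (ε / 2) := by
    refine (eLpNorm_le_of_ae_bound (C := ε / 2) ?_).trans (by simp)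
    filter_upwards [ae_restrict_mem (measurableSet_Icc.prod measurableSet_Icc)] with z hz
    exact hgu z hz
  calc eLpNorm (f - u) 2 squareVol = eLpNorm ((f - g) + (g - u)) 2 squareVol := by
        rw [sub_add_sub_cancel]
    _ ≤ eLpNorm (f - g) 2 squareVol + eLpNorm (g - u) 2 squareVol :=
        eLpNorm_add_le (hf.1.sub hgL.1) (hgL.1.sub hu.measurable.aestronglyMeasurable) (by simp)
    _ ≤ ENNReal.ofReal (ε / 2) + ENNReal.ofReal (ε / 2) := add_le_add hfg h2
    _ = ENNReal.ofReal ε := by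
        rw [← ENNReal.ofReal_add (by positivity) (by positivity), add_halves]

lemma eLpNorm_le_sum_eLpNorm_apply {α ι : Type*} [Fintype ι] [MeasurableSpace α] {μ : Measure α}
    {f : α → ι → ℂ} (hf : ∀ i, AEStronglyMeasurable (fun x => f x i) μ) :
    eLpNorm f 2 μ ≤ ∑ i, eLpNorm (fun x => f x i) 2 μ := by
  calc eLpNorm f 2 μ ≤ eLpNorm (∑ i, fun x => ‖f x i‖) 2 μ := by
        refine eLpNorm_mono_real fun x => ?_
        rw [Finset.sum_apply]
        exact (pi_norm_le_iff_of_nonneg (by positivity)).2 fun i =>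
          Finset.single_le_sum (f := fun i => ‖f x i‖) (fun j _ => norm_nonneg _)
            (Finset.mem_univ i)
    _ ≤ ∑ i, eLpNorm (fun x => ‖f x i‖) 2 μ :=
        eLpNorm_sum_le (fun i _ => (hf i).norm) (by simp)
    _ = _ := by simp only [eLpNorm_norm]

lemma exists_elemOn_pi_eLpNorm_sub_le {n : ℕ} {f : ℝ × ℝ → Fin n → ℂ} (hf : MemLp f 2 squareVol)
    {ε : ℝ} (hε : 0 < ε) : ∃ u : ℝ × ℝ → Fin n → ℂ, (∀ i, ElemOn fun z => u z i) ∧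
      eLpNorm (f - u) 2 squareVol ≤ ENNReal.ofReal ε := by
  have hfi : ∀ i, MemLp (fun z => f z i) 2 squareVol := fun i =>
    hf.mono ((continuous_apply i).comp_aestronglyMeasurable hf.1)
      (.of_forall fun z => norm_le_pi_norm (f z) i)
  have hδ : 0 < ε / (n + 1) := by positivity
  choose u hu hfu using fun i => exists_elemOn_eLpNorm_sub_le (hfi i) hδ
  refine ⟨fun z i => u i z, hu, (eLpNorm_le_sum_eLpNorm_apply fun i =>
    (hfi i).1.sub (hu i).measurable.aestronglyMeasurable).trans
    ((Finset.sum_le_sum fun i _ => hfu i).trans ?_)⟩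
  rw [← ENNReal.ofReal_sum_of_nonneg fun _ _ => hδ.le]
  refine ENNReal.ofReal_le_ofReal ?_
  rw [Finset.sum_const, Finset.card_univ, Fintype.card_fin, nsmul_eq_mul, mul_div_assoc',
    div_le_iff₀ (by positivity)]
  nlinarith

section LinearAlgebra

open Matrix Polynomial
open scoped ComplexOrder

/-- The polynomial in `H` obtained from the characteristic polynomial of `H` by dividing out
`X ^ k`, evaluated at `H`. -/
noncomputable def shiftedCharpoly {R : Type*} [CommRing R] {n : ℕ} (H : Matrix (Fin n) (Fin n) R)
    (k : ℕ) : Matrix (Fin n) (Fin n) R :=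
  ∑ i ∈ Finset.range (n + 1), H.charpoly.coeff (i + k) • H ^ i

lemma shiftedCharpoly_map {R S : Type*} [CommRing R] [CommRing S] {n : ℕ} (f : R →+* S)
    (H : Matrix (Fin n) (Fin n) R) (k : ℕ) :
    shiftedCharpoly (H.map f) k = (shiftedCharpoly H k).map f := by
  have hsmul : ∀ (c : R) (A : Matrix (Fin n) (Fin n) R),
      f.mapMatrix (c • A) = f c • f.mapMatrix A := fun c A => by
    ext i j
    simp
  rw [← RingHom.mapMatrix_apply, ← RingHom.mapMatrix_apply, shiftedCharpoly, shiftedCharpoly,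
    map_sum]
  simp only [hsmul, map_pow, RingHom.mapMatrix_apply, charpoly_map, coeff_map]

lemma pow_mul_shiftedCharpoly {n : ℕ} (H : Matrix (Fin n) (Fin n) ℂ) {k : ℕ}
    (h : ∀ i < k, H.charpoly.coeff i = 0) : H ^ k * shiftedCharpoly H k = 0 := by
  obtain ⟨q, hq⟩ := X_pow_dvd_iff.2 h
  have hdeg : q.natDegree < n + 1 := by
    have h1 := natDegree_le_of_dvd (Dvd.intro_left _ hq.symm) H.charpoly_monic.ne_zero
    rw [charpoly_natDegree_eq_dim, Fintype.card_fin] at h1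
    omega
  have h2 : aeval H q = shiftedCharpoly H k := by
    rw [aeval_eq_sum_range' hdeg, shiftedCharpoly]
    refine Finset.sum_congr rfl fun i _ => ?_
    rw [hq, coeff_X_pow_mul]
  have h3 := H.aeval_self_charpoly
  rwa [hq, map_mul, map_pow, aeval_X, h2] at h3

lemma mul_eq_zero_of_conjTranspose_mul_self_pow_mul_eq_zero {n : ℕ}
    (A B : Matrix (Fin n) (Fin n) ℂ) (k : ℕ) (h : (Aᴴ * A) ^ k * B = 0) : A * B = 0 := by
  induction k with
  | zero => simp_all
  | succ k ih =>
    rcases k with _ | k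
    · rwa [zero_add, pow_one, conjTranspose_mul_self_mul_eq_zero] at h
    · refine ih ?_
      rw [pow_succ', mul_assoc, ← conjTranspose_mul_self_mul_eq_zero, conjTranspose_mul,
        conjTranspose_conjTranspose, ← mul_assoc, ← pow_two, ← pow_add]
      rwa [add_comm 2 k]

lemma mul_shiftedCharpoly_eq_zero {n : ℕ} (A : Matrix (Fin n) (Fin n) ℂ) {k : ℕ}
    (h : ∀ i < k, (Aᴴ * A).charpoly.coeff i = 0) : A * shiftedCharpoly (Aᴴ * A) k = 0 :=
  mul_eq_zero_of_conjTranspose_mul_self_pow_mul_eq_zero A _ k (pow_mul_shiftedCharpoly _ h)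

lemma shiftedCharpoly_mulVec {n : ℕ} (H : Matrix (Fin n) (Fin n) ℂ) (k : ℕ) {v : Fin n → ℂ}
    (hv : H *ᵥ v = 0) : shiftedCharpoly H k *ᵥ v = H.charpoly.coeff k • v := by
  rw [shiftedCharpoly, sum_mulVec, Finset.sum_eq_single 0]
  · rw [zero_add, pow_zero, smul_mulVec, one_mulVec]
  · intro i _ hi
    obtain ⟨j, rfl⟩ := Nat.exists_eq_succ_of_ne_zero hi
    rw [smul_mulVec, pow_succ, ← mulVec_mulVec, hv, mulVec_zero, smul_zero]
  · simp

end LinearAlgebra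

/-- A set `B` is uniform for `u` with respect to `ν` if every slice `u (x, ·)` either vanishes
almost everywhere on `B` or is nonzero almost everywhere on `B`. -/
def UniformOn (ν : Measure ℝ) (u : ℝ × ℝ → ℂ) (B : Set ℝ) : Prop :=
  ∀ x, (∀ᵐ y ∂ν, y ∈ B → u (x, y) = 0) ∨ (∀ᵐ y ∂ν, y ∈ B → u (x, y) ≠ 0)

lemma UniformOn.mono {ν : Measure ℝ} {u : ℝ × ℝ → ℂ} {B B' : Set ℝ} (h : UniformOn ν u B)
    (hB : B' ⊆ B) : UniformOn ν u B' := fun x =>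
  (h x).imp (fun h => h.mono fun _ hy hy' => hy (hB hy')) fun h =>
    h.mono fun _ hy hy' => hy (hB hy')

lemma ElemOn.exists_uniformOn {ν : Measure ℝ} {u : ℝ × ℝ → ℂ} (hu : ElemOn u) {B : Set ℝ}
    (hB : MeasurableSet B) (hνB : ν B ≠ 0) :
    ∃ B' ⊆ B, MeasurableSet B' ∧ ν B' ≠ 0 ∧ UniformOn ν u B' := by
  classical
  obtain ⟨L, a, b, -, hb, -, -, hu⟩ := hu
  let h : ℝ → Fin L → ℂ := fun y l => b l y
  have hh : Measurable h := measurable_pi_lambda _ hb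
  have hmeas : ∀ V : Submodule ℂ (Fin L → ℂ), MeasurableSet (B ∩ h ⁻¹' V) := fun V =>
    hB.inter (hh V.closed_of_finiteDimensional.measurableSet)
  have hex : ∃ d, ∃ V : Submodule ℂ (Fin L → ℂ), Module.finrank ℂ V = d ∧
      ν (B ∩ h ⁻¹' V) ≠ 0 := ⟨_, ⊤, rfl, by simpa using hνB⟩
  obtain ⟨V, hVd, hV⟩ := Nat.find_spec hex
  refine ⟨B ∩ h ⁻¹' V, inter_subset_left, hmeas V, hV, fun x => ?_⟩
  let φ : (Fin L → ℂ) →ₗ[ℂ] ℂ := ∑ l, a l x • LinearMap.proj l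
  have hφ : ∀ y, u (x, y) = φ (h y) := fun y => by simp [φ, h, hu]
  by_cases hle : V ≤ LinearMap.ker φ
  · exact .inl (.of_forall fun y hy => (hφ y).trans (hle hy.2))
  · right
    have hlt : V ⊓ LinearMap.ker φ < V := inf_lt_left.2 hle
    have hnull : ν (B ∩ h ⁻¹' (V ⊓ LinearMap.ker φ : Submodule ℂ (Fin L → ℂ))) = 0 := by
      by_contra hne
      exact Nat.find_min hex (hVd ▸ Submodule.finrank_lt_finrank_of_lt hlt) ⟨_, rfl, hne⟩
    filter_upwards [measure_eq_zero_iff_ae_notMem.1 hnull] with y hy hyV hzero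
    exact hy ⟨hyV.1, hyV.2, (hφ y).symm.trans hzero⟩

lemma exists_uniformOn_finset {ι : Type*} {ν : Measure ℝ} {u : ι → ℝ × ℝ → ℂ}
    (hu : ∀ i, ElemOn (u i)) (s : Finset ι) {B : Set ℝ} (hB : MeasurableSet B) (hνB : ν B ≠ 0) :
    ∃ B' ⊆ B, MeasurableSet B' ∧ ν B' ≠ 0 ∧ ∀ i ∈ s, UniformOn ν (u i) B' := by
  classical
  induction s using Finset.induction_on with
  | empty => exact ⟨B, Subset.rfl, hB, hνB, by simp⟩
  | insert i s _ ih =>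
    obtain ⟨B₁, hB₁, hm₁, hν₁, hs⟩ := ih
    obtain ⟨B₂, hB₂, hm₂, hν₂, hi⟩ := (hu i).exists_uniformOn hm₁ hν₁
    refine ⟨B₂, hB₂.trans hB₁, hm₂, hν₂, fun j hj => ?_⟩
    rcases Finset.mem_insert.1 hj with rfl | hj
    exacts [hi, (hs j hj).mono hB₂]

lemma exists_seq_ae_cover {α : Type*} [MeasurableSpace α] {ν : Measure α} [IsFiniteMeasure ν]
    {P : Set α → Prop} (hP₀ : P ∅)
    (hP : ∀ B, MeasurableSet B → ν B ≠ 0 → ∃ B' ⊆ B, MeasurableSet B' ∧ ν B' ≠ 0 ∧ P B') :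
    ∃ B : ℕ → Set α, (∀ k, MeasurableSet (B k)) ∧ (∀ k, P (B k)) ∧ ∀ᵐ y ∂ν, ∃ k, y ∈ B k := by
  let C : Set (ℕ → Set α) := {B | ∀ k, MeasurableSet (B k) ∧ P (B k)}
  let m : (ℕ → Set α) → ℝ≥0∞ := fun B => ν (⋃ k, B k)
  have hne : (m '' C).Nonempty := ⟨_, fun _ => ∅, fun _ => ⟨.empty, hP₀⟩, rfl⟩
  obtain ⟨t, -, ht, htC⟩ := exists_seq_tendsto_sSup hne (OrderTop.bddAbove _)
  choose D hDC hD using htC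
  let B : ℕ → Set α := fun k => D k.unpair.1 k.unpair.2
  have hBC : B ∈ C := fun k => hDC _ _
  have hsub : ∀ i, ⋃ k, D i k ⊆ ⋃ k, B k := fun i => iUnion_subset fun k =>
    subset_iUnion_of_subset (Nat.pair i k) (by simp [B])
  have hsup : sSup (m '' C) ≤ m B :=
    le_of_tendsto ht (.of_forall fun i => (hD i).symm.le.trans (measure_mono (hsub i)))
  have hBm : MeasurableSet (⋃ k, B k) := .iUnion fun k => (hBC k).1
  refine ⟨B, fun k => (hBC k).1, fun k => (hBC k).2, ?_⟩
  suffices h : ν (⋃ k, B k)ᶜ = 0 by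
    filter_upwards [measure_eq_zero_iff_ae_notMem.1 h] with y hy
    simpa using hy
  by_contra h
  obtain ⟨A, hA, hAm, hνA, hPA⟩ := hP _ hBm.compl h
  let B' : ℕ → Set α := fun k => Nat.casesOn k A B
  have hB'C : B' ∈ C := by
    rintro (_ | k)
    exacts [⟨hAm, hPA⟩, hBC k]
  have hB' : ⋃ k, B' k = (⋃ k, B k) ∪ A := by
    rw [union_comm]
    exact (sup_iSup_nat_succ B').symm
  have hlt : m B < m B' := by
    show ν _ < ν _
    rw [hB', measure_union (subset_compl_iff_disjoint_left.1 hA) hAm]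
    exact ENNReal.lt_add_right (measure_ne_top _ _) hνA
  exact (hlt.trans_le ((le_sSup (mem_image_of_mem m hB'C)).trans hsup)).false

/-- The square is covered by countably many rectangles, on each of which some `u k` is nonzero
almost everywhere while all preceding `u i` vanish almost everywhere. -/
lemma exists_rectangle_cover {n : ℕ} {u : ℕ → ℝ × ℝ → ℂ} (hu : ∀ i, ElemOn (u i))
    (hun : ∀ z, u n z ≠ 0) :
    ∃ (X Y : ℕ → Set ℝ) (κ : ℕ → ℕ), (∀ j, MeasurableSet (X j)) ∧ (∀ j, MeasurableSet (Y j)) ∧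
      (∀ j, ∀ᵐ z ∂squareVol, z ∈ X j ×ˢ Y j → (∀ i < κ j, u i z = 0) ∧ u (κ j) z ≠ 0) ∧
      ∀ᵐ z ∂squareVol, ∃ j, z ∈ X j ×ˢ Y j := by
  obtain ⟨B, hBm, hB, hcov⟩ := exists_seq_ae_cover (ν := unitVol)
    (P := fun B => ∀ i ∈ Finset.range (n + 1), UniformOn unitVol (u i) B)
    (fun i _ x => .inl (by simp))
    (fun B => exists_uniformOn_finset hu _)
  let Z : ℕ → ℕ → Set ℝ := fun i k => {x | ∀ᵐ y ∂unitVol, y ∈ B k → u i (x, y) = 0}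
  have hZ : ∀ i k, MeasurableSet (Z i k) := fun i k => by
    have hs : MeasurableSet {p : ℝ × ℝ | ¬(p.2 ∈ B k → u i p = 0)} :=
      ((measurable_snd (hBm k)).imp ((hu i).measurable (measurableSet_singleton 0))).compl
    exact measurable_measure_prodMk_left (ν := unitVol) hs (measurableSet_singleton 0)
  let W : ℕ → ℕ → Set ℝ := fun i k => {x | ∀ᵐ y ∂unitVol, y ∈ B k → u i (x, y) ≠ 0}
  have hW : ∀ i k, MeasurableSet (W i k) := fun i k => by
    have hs : MeasurableSet {p : ℝ × ℝ | ¬(p.2 ∈ B k → u i p ≠ 0)} :=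
      ((measurable_snd (hBm k)).imp ((hu i).measurable (measurableSet_singleton 0)).compl).compl
    exact measurable_measure_prodMk_left (ν := unitVol) hs (measurableSet_singleton 0)
  have hZae : ∀ i k, ∀ᵐ z ∂squareVol, z.1 ∈ Z i k → z.2 ∈ B k → u i z = 0 := fun i k => by
    rw [squareVol_eq_prod]
    refine (Measure.ae_prod_mem_iff_ae_ae_mem ((measurable_fst (hZ i k)).imp
      ((measurable_snd (hBm k)).imp ((hu i).measurable (measurableSet_singleton 0))))).2
      (.of_forall fun x => ?_)
    by_cases hx : x ∈ Z i k
    · filter_upwards [hx] with y hy _ using hy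
    · exact .of_forall fun y hx' => absurd hx' hx
  have hWae : ∀ i k, ∀ᵐ z ∂squareVol, z.1 ∈ W i k → z.2 ∈ B k → u i z ≠ 0 := fun i k => by
    rw [squareVol_eq_prod]
    refine (Measure.ae_prod_mem_iff_ae_ae_mem ((measurable_fst (hW i k)).imp
      ((measurable_snd (hBm k)).imp ((hu i).measurable (measurableSet_singleton 0)).compl))).2
      (.of_forall fun x => ?_)
    by_cases hx : x ∈ W i k
    · filter_upwards [hx] with y hy _ using hy
    · exact .of_forall fun y hx' => absurd hx' hx
  refine ⟨fun j => (⋂ i ∈ Finset.range j.unpair.1, Z i j.unpair.2) ∩ W j.unpair.1 j.unpair.2,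
    fun j => B j.unpair.2, fun j => j.unpair.1, fun j => ?_, fun j => hBm _, fun j => ?_, ?_⟩
  · exact (Finset.measurableSet_biInter _ fun i _ => hZ _ _).inter (hW _ _)
  · filter_upwards [ae_all_iff.2 fun i => hZae i j.unpair.2, hWae j.unpair.1 j.unpair.2]
      with z hz hw hzj
    exact ⟨fun i hi => hz i (mem_iInter₂.1 hzj.1.1 i (Finset.mem_range.2 hi)) hzj.2,
      hw hzj.1.2 hzj.2⟩
  · rw [squareVol_eq_prod]
    have h2 : ∀ᵐ z ∂unitVol.prod unitVol, ∃ k, z.2 ∈ B k :=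
      Measure.quasiMeasurePreserving_snd.ae hcov
    filter_upwards [h2] with z ⟨k, hk⟩
    have hWn : z.1 ∈ W n k :=
      show ∀ᵐ y ∂unitVol, y ∈ B k → u n (z.1, y) ≠ 0 from .of_forall fun y _ => hun _
    have hex : ∃ i, z.1 ∈ W i k := ⟨n, hWn⟩
    classical
    refine ⟨Nat.pair (Nat.find hex) k, ?_⟩
    rw [Nat.unpair_pair]
    refine ⟨⟨mem_iInter₂.2 fun i hi => ?_, Nat.find_spec hex⟩, hk⟩
    have hi' : i < Nat.find hex := Finset.mem_range.1 hi
    have hin : i ∈ Finset.range (n + 1) := Finset.mem_range.2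
      ((hi'.trans_le (Nat.find_min' hex hWn)).trans (Nat.lt_succ_self n))
    exact (hB k i hin z.1).resolve_right (Nat.find_min hex hi')

section Approximation

open Matrix

variable {n : ℕ} {F : ℝ × ℝ → Matrix (Fin n) (Fin n) ℂ} {v v' : ℝ × ℝ → Fin n → ℂ}

/-- The vector field `v` is an `L²`-limit of elementary vector fields in the kernel of `F`. -/
def KerApprox (F : ℝ × ℝ → Matrix (Fin n) (Fin n) ℂ) (v : ℝ × ℝ → Fin n → ℂ) : Prop :=
  ∀ ε : ℝ, 0 < ε → ∃ w : ℝ × ℝ → Fin n → ℂ, (∀ i, ElemOn fun z => w z i) ∧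
    (∀ᵐ z ∂squareVol, F z *ᵥ w z = 0) ∧ eLpNorm (v - w) 2 squareVol ≤ ENNReal.ofReal ε

lemma measurable_of_elemOn {w : ℝ × ℝ → Fin n → ℂ} (hw : ∀ i, ElemOn fun z => w z i) :
    Measurable w :=
  measurable_pi_lambda _ fun i => (hw i).measurable

lemma KerApprox.zero : KerApprox F 0 := fun ε _ =>
  ⟨0, fun _ => ElemOn.const 0, .of_forall fun z => by simp, by simp⟩

lemma KerApprox.add (hv : Measurable v) (hv' : Measurable v') (h : KerApprox F v)
    (h' : KerApprox F v') : KerApprox F (v + v') := by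
  intro ε hε
  obtain ⟨w, hw, hFw, hvw⟩ := h (ε / 2) (half_pos hε)
  obtain ⟨w', hw', hFw', hvw'⟩ := h' (ε / 2) (half_pos hε)
  refine ⟨w + w', fun i => (hw i).add (hw' i), ?_, ?_⟩
  · filter_upwards [hFw, hFw'] with z h1 h2
    rw [Pi.add_apply, mulVec_add, h1, h2, add_zero]
  · rw [add_sub_add_comm]
    refine (eLpNorm_add_le (hv.sub (measurable_of_elemOn hw)).aestronglyMeasurable
      (hv'.sub (measurable_of_elemOn hw')).aestronglyMeasurable (by simp)).trans
      ((add_le_add hvw hvw').trans ?_)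
    rw [← ENNReal.ofReal_add (by positivity) (by positivity), add_halves]

/-- It suffices to approximate the restrictions of `v` to an exhausting sequence of sets. -/
lemma KerApprox.of_indicator (hvm : Measurable v) (hv : MemLp v 2 squareVol)
    {A : ℕ → Set (ℝ × ℝ)} (hA : ∀ N, MeasurableSet (A N)) (hmono : Monotone A)
    (hcov : ∀ᵐ z ∂squareVol, ∃ N, z ∈ A N) (h : ∀ N, KerApprox F ((A N).indicator v)) :
    KerApprox F v := by
  intro ε hε
  obtain ⟨δ, hδ, hsmall⟩ := hv.eLpNorm_indicator_le (by simp) (by simp) (half_pos hε)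
  have hlim : Filter.Tendsto (fun N => squareVol (A N)ᶜ) Filter.atTop (nhds 0) := by
    have hnull : squareVol (⋂ N, (A N)ᶜ) = 0 := by
      refine measure_eq_zero_iff_ae_notMem.2 (hcov.mono fun z hz => ?_)
      simpa using hz
    rw [← hnull]
    exact tendsto_measure_iInter_atTop (fun N => (hA N).compl.nullMeasurableSet)
      (fun _ _ hij => compl_subset_compl.2 (hmono hij)) ⟨0, measure_ne_top _ _⟩
  obtain ⟨N, hN⟩ := (hlim.eventually (gt_mem_nhds (ENNReal.ofReal_pos.2 hδ))).exists
  obtain ⟨w, hw, hFw, hvw⟩ := h N (ε / 2) (half_pos hε)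
  refine ⟨w, hw, hFw, ?_⟩
  have hsplit : v - w = (A N)ᶜ.indicator v + ((A N).indicator v - w) := by
    rw [← add_sub_assoc, indicator_compl_add_self]
  rw [hsplit]
  refine (eLpNorm_add_le (hvm.indicator (hA N).compl).aestronglyMeasurable
    ((hvm.indicator (hA N)).sub (measurable_of_elemOn hw)).aestronglyMeasurable (by simp)).trans
    ((add_le_add (hsmall _ (hA N).compl hN.le) hvw).trans ?_)
  rw [← ENNReal.ofReal_add (by positivity) (by positivity), add_halves]

lemma exists_bound_mulVec {Q : ℝ × ℝ → Matrix (Fin n) (Fin n) ℂ}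
    (hQ : ∀ i j, ElemOn fun z => Q z i j) :
    ∃ C : ℝ, 0 < C ∧ ∀ z ∈ Icc (0:ℝ) 1 ×ˢ Icc (0:ℝ) 1, ∀ x, ‖Q z *ᵥ x‖ ≤ C * ‖x‖ := by
  choose c hc using fun i j => (hQ i j).exists_bound
  have hc' : ∀ i j, 0 ≤ |c i j| := fun i j => abs_nonneg _
  refine ⟨∑ i, ∑ j, |c i j| + 1, by positivity, fun z hz x => ?_⟩
  refine (pi_norm_le_iff_of_nonneg (by positivity)).2 fun i => ?_
  calc ‖∑ j, Q z i j * x j‖ ≤ ∑ j, |c i j| * ‖x‖ := by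
        refine norm_sum_le_of_le _ fun j _ => ?_
        rw [norm_mul]
        exact mul_le_mul ((hc i j z hz).trans (le_abs_self _)) (norm_le_pi_norm x j)
          (norm_nonneg _) (hc' i j)
    _ = (∑ j, |c i j|) * ‖x‖ := (Finset.sum_mul _ _ _).symm
    _ ≤ (∑ i, ∑ j, |c i j| + 1) * ‖x‖ := by
        refine mul_le_mul_of_nonneg_right ?_ (norm_nonneg _)
        exact (Finset.single_le_sum (f := fun i => ∑ j, |c i j|)
          (fun i _ => Finset.sum_nonneg fun j _ => hc' i j) (Finset.mem_univ i)).trans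
          (le_add_of_nonneg_right zero_le_one)

/-- If `v = Q u` on `R`, with `Q` an elementary matrix whose columns lie in the kernel of `F`
on `R`, then `v` restricted to `R` can be approximated in the kernel of `F`. -/
lemma KerApprox.of_mulVec {Q : ℝ × ℝ → Matrix (Fin n) (Fin n) ℂ}
    (hQ : ∀ i j, ElemOn fun z => Q z i j) {R : Set (ℝ × ℝ)} (hR : ElemOn (R.indicator 1))
    (hFQ : ∀ᵐ z ∂squareVol, z ∈ R → F z * Q z = 0) {u : ℝ × ℝ → Fin n → ℂ}
    (hu : MemLp u 2 squareVol) (hv : ∀ᵐ z ∂squareVol, z ∈ R → v z = Q z *ᵥ u z) :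
    KerApprox F (R.indicator v) := by
  intro ε hε
  obtain ⟨C, hC, hQC⟩ := exists_bound_mulVec hQ
  obtain ⟨u', hu', huu'⟩ := exists_elemOn_pi_eLpNorm_sub_le hu (div_pos hε hC)
  refine ⟨R.indicator fun z => Q z *ᵥ u' z, fun i => ?_, ?_, ?_⟩
  · convert hR.mul (ElemOn.sum Finset.univ fun j _ => (hQ i j).mul (hu' j)) using 1
    ext z
    by_cases hz : z ∈ R <;> simp [hz, mulVec, dotProduct]
  · filter_upwards [hFQ] with z hz
    by_cases hzR : z ∈ R
    · rw [indicator_of_mem hzR, mulVec_mulVec, hz hzR, zero_mulVec]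
    · rw [indicator_of_notMem hzR, mulVec_zero]
  · refine (eLpNorm_le_mul_eLpNorm_of_ae_le_mul (g := u - u') (c := C) ?_ 2).trans
      ((mul_le_mul_right huu' _).trans ?_)
    · filter_upwards [hv, ae_restrict_mem (measurableSet_Icc.prod measurableSet_Icc)] with z hz hzS
      by_cases hzR : z ∈ R
      · rw [Pi.sub_apply, indicator_of_mem hzR, indicator_of_mem hzR, hz hzR, ← mulVec_sub]
        exact hQC z hzS _
      · rw [Pi.sub_apply, indicator_of_notMem hzR, indicator_of_notMem hzR, sub_zero, norm_zero]
        positivity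
    · rw [← ENNReal.ofReal_mul hC.le, mul_div_cancel₀ _ hC.ne']

lemma kerApprox_indicator {Q : ℝ × ℝ → Matrix (Fin n) (Fin n) ℂ}
    (hQ : ∀ i j, ElemOn fun z => Q z i j) {R : Set (ℝ × ℝ)} (hRm : MeasurableSet R)
    (hR : ElemOn (R.indicator 1))
    (hFQ : ∀ᵐ z ∂squareVol, z ∈ R → F z * Q z = 0) (hvm : Measurable v)
    (hvL : MemLp v 2 squareVol) {c : ℝ × ℝ → ℂ} (hcm : Measurable c)
    (hc : ∀ᵐ z ∂squareVol, z ∈ R → c z ≠ 0)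
    (hv : ∀ᵐ z ∂squareVol, z ∈ R → Q z *ᵥ v z = c z • v z) :
    KerApprox F (R.indicator v) := by
  let A : ℕ → Set (ℝ × ℝ) := fun N => Rᶜ ∪ {z | 1 / ((N : ℝ) + 1) < ‖c z‖}
  have hA' : ∀ N, MeasurableSet {z | 1 / ((N : ℝ) + 1) < ‖c z‖} := fun N =>
    measurableSet_lt measurable_const hcm.norm
  refine KerApprox.of_indicator (A := A) (hvm.indicator hRm) (hvL.indicator hRm)
    (fun N => hRm.compl.union (hA' N)) (fun M N hMN => ?_) ?_ fun N => ?_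
  · exact union_subset_union_right _ fun z hz =>
      (one_div_le_one_div_of_le (α := ℝ) (by positivity)
        (by exact_mod_cast Nat.succ_le_succ hMN)).trans_lt hz
  · filter_upwards [hc] with z hz
    by_cases hzR : z ∈ R
    · obtain ⟨N, hN⟩ := exists_nat_one_div_lt (norm_pos_iff.2 (hz hzR))
      exact ⟨N, .inr hN⟩
    · exact ⟨0, .inl hzR⟩
  · let T : Set (ℝ × ℝ) := {z | 1 / ((N : ℝ) + 1) < ‖c z‖}
    have hswap : (A N).indicator (R.indicator v) = R.indicator (T.indicator v) := by
      ext z i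
      by_cases h1 : z ∈ R <;> by_cases h2 : z ∈ T <;> simp_all [A, T, Set.indicator]
    rw [hswap]
    refine KerApprox.of_mulVec hQ hR hFQ (u := fun z => (c z)⁻¹ • T.indicator v z) ?_ ?_
    · refine MemLp.of_le_mul (c := (N : ℝ) + 1) hvL
        (hcm.inv.smul (hvm.indicator (hA' N))).aestronglyMeasurable (.of_forall fun z => ?_)
      by_cases hz : z ∈ T
      · rw [indicator_of_mem hz, norm_smul, norm_inv]
        refine mul_le_mul_of_nonneg_right ?_ (norm_nonneg _)
        exact inv_le_of_inv_le₀ (by positivity)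
          (by simpa using le_of_lt (show 1 / ((N : ℝ) + 1) < ‖c z‖ from hz))
      · rw [indicator_of_notMem hz, smul_zero, norm_zero]
        positivity
    · filter_upwards [hc, hv] with z hz hvz hzR
      by_cases hzT : z ∈ T
      · rw [indicator_of_mem hzT, mulVec_smul, hvz hzR, inv_smul_smul₀ (hz hzR)]
      · rw [indicator_of_notMem hzT, smul_zero, mulVec_zero]

/-- Approximability on each member of a countable family of rectangles covering the square
implies approximability. -/
lemma KerApprox.of_rectangles (hvm : Measurable v) (hvL : MemLp v 2 squareVol)
    {R : ℕ → Set (ℝ × ℝ)} (hRm : ∀ j, MeasurableSet (R j))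
    (hcov : ∀ᵐ z ∂squareVol, ∃ j, z ∈ R j)
    (h : ∀ j (D : Set (ℝ × ℝ)), MeasurableSet D → KerApprox F ((R j).indicator (D.indicator v))) :
    KerApprox F v := by
  have hpart : ∀ N, MeasurableSet (⋃ j ∈ Finset.range N, R j) := fun N =>
    Finset.measurableSet_biUnion _ fun j _ => hRm j
  refine KerApprox.of_indicator hvm hvL hpart ?_ ?_ fun N => ?_
  · exact fun M N hMN => biUnion_subset_biUnion_left fun j hj =>
      Finset.range_mono hMN hj
  · filter_upwards [hcov] with z ⟨j, hj⟩
    exact ⟨j + 1, mem_biUnion (Finset.mem_coe.2 (Finset.self_mem_range_succ j)) hj⟩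
  · induction N with
    | zero => simpa using! KerApprox.zero
    | succ N ih =>
      let D := (⋃ j ∈ Finset.range N, R j)ᶜ
      have hD : MeasurableSet D := (hpart N).compl
      have hsplit : (⋃ j ∈ Finset.range (N + 1), R j).indicator v =
          (⋃ j ∈ Finset.range N, R j).indicator v + (R N).indicator (D.indicator v) := by
        rw [Finset.range_add_one, Finset.set_biUnion_insert, union_comm]
        ext z i
        by_cases h1 : z ∈ ⋃ j ∈ Finset.range N, R j <;> by_cases h2 : z ∈ R N <;>
          simp only [Set.indicator, D, mem_union, mem_compl_iff, h1, h2, Pi.add_apply] <;> simp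
      rw [hsplit]
      exact ih.add (hvm.indicator (hpart N)) ((hvm.indicator hD).indicator (hRm N)) (h N D hD)

theorem kerApprox_of_ker (hF : ∀ i j, ElemOn fun z => F z i j) (hvm : Measurable v)
    (hvL : MemLp v 2 squareVol) (hv : ∀ᵐ z ∂squareVol, F z *ᵥ v z = 0) : KerApprox F v := by
  have hH : ∀ i j, ElemOn fun z => ((F z)ᴴ * F z) i j := fun i j => by
    convert ElemOn.sum Finset.univ fun l _ => (hF l i).star.mul (hF l j) using 1
    ext z
    simp [Matrix.mul_apply]
  let H : Matrix (Fin n) (Fin n) elemAlg := fun i j => ⟨_, hH i j⟩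
  have hHz : ∀ z, H.map (elemEval z) = (F z)ᴴ * F z := fun z => rfl
  let c : ℕ → ℝ × ℝ → ℂ := fun k z => ((F z)ᴴ * F z).charpoly.coeff k
  have hc : ∀ k, ElemOn (c k) := fun k => by
    have hmem : ElemOn (H.charpoly.coeff k : elemAlg) := (H.charpoly.coeff k).2
    convert hmem using 1
    ext z
    simp only [c, ← hHz, charpoly_map, Polynomial.coeff_map]
    rfl
  let Q : ℕ → ℝ × ℝ → Matrix (Fin n) (Fin n) ℂ := fun k z => shiftedCharpoly ((F z)ᴴ * F z) k
  have hQ : ∀ k i j, ElemOn fun z => Q k z i j := fun k i j => by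
    have hmem : ElemOn (shiftedCharpoly H k i j : elemAlg) := (shiftedCharpoly H k i j).2
    convert hmem using 1
    ext z
    simp only [Q, ← hHz, shiftedCharpoly_map]
    rfl
  have hcn : ∀ z, c n z ≠ 0 := fun z => by
    have := ((F z)ᴴ * F z).charpoly_monic.coeff_natDegree
    rw [charpoly_natDegree_eq_dim, Fintype.card_fin] at this
    simp [c, this]
  obtain ⟨X, Y, κ, hX, hY, hκ, hcov⟩ := exists_rectangle_cover hc hcn
  refine KerApprox.of_rectangles hvm hvL (fun j => (hX j).prod (hY j)) hcov fun j D hD => ?_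
  refine kerApprox_indicator (hQ (κ j)) ((hX j).prod (hY j))
    (ElemOn.indicator_prod (hX j) (hY j)) ?_ (hvm.indicator hD) (hvL.indicator hD)
    (hc (κ j)).measurable ?_ ?_
  · filter_upwards [hκ j] with z hz hzR
    exact mul_shiftedCharpoly_eq_zero _ (hz hzR).1
  · filter_upwards [hκ j] with z hz hzR
    exact (hz hzR).2
  · filter_upwards [hv] with z hz _
    refine shiftedCharpoly_mulVec _ _ ?_
    by_cases hzD : z ∈ D
    · rw [indicator_of_mem hzD, ← mulVec_mulVec, hz, mulVec_zero]
    · rw [indicator_of_notMem hzD, mulVec_zero]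

end Approximation

lemma eLpNorm_two_sq_eq_lintegral {α E : Type*} [MeasurableSpace α] [NormedAddCommGroup E]
    (μ : Measure α) (f : α → E) : eLpNorm f 2 μ ^ 2 = ∫⁻ x, ‖f x‖ₑ ^ 2 ∂μ := by
  simpa using eLpNorm_nnreal_pow_eq_lintegral (μ := μ) (f := f) (p := 2) (by simp)

/-- Appendix I, Theorem, part (i), concrete form: for a matrix `F` with elementary
entries, every square-integrable a.e.-kernel vector field `v` of `F` on `[0,1]²` can
be approximated in `L²` by kernel vector fields with elementary components. -/
theorem stmt11 (n : ℕ) (hn : 1 ≤ n)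
    (F : ℝ × ℝ → Matrix (Fin n) (Fin n) ℂ)
    (hF : ∀ i j : Fin n, ElemOn fun p => F p i j)
    (S : Set (ℝ × ℝ)) (hS : S = Icc (0:ℝ) 1 ×ˢ Icc (0:ℝ) 1)
    (v : ℝ × ℝ → Fin n → ℂ) (hvmeas : Measurable v)
    (hvL2 : ∀ i : Fin n, ∫⁻ z in S, (‖v z i‖₊ : ℝ≥0∞) ^ 2 < ⊤)
    (hvker : ∀ᵐ z ∂(volume.restrict S), (F z).mulVec (v z) = 0)
    (ε : ℝ) (hε : 0 < ε) :
    ∃ w : ℝ × ℝ → Fin n → ℂ,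
      (∀ i : Fin n, ElemOn fun p => w p i) ∧
      (∀ᵐ z ∂(volume.restrict S), (F z).mulVec (w z) = 0) ∧
      ∑ i : Fin n, ∫⁻ z in S, (‖v z i - w z i‖₊ : ℝ≥0∞) ^ 2 < ENNReal.ofReal ε := by
  subst hS
  have hvL : MemLp v 2 squareVol := by
    refine ⟨hvmeas.aestronglyMeasurable, (eLpNorm_le_sum_eLpNorm_apply fun i =>
      ((measurable_pi_apply i).comp hvmeas).aestronglyMeasurable).trans_lt
      (ENNReal.sum_lt_top.2 fun i _ => ?_)⟩
    have := hvL2 i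
    refine (ENNReal.pow_lt_top_iff.1 ?_).resolve_right two_ne_zero
    rw [eLpNorm_two_sq_eq_lintegral]
    exact this
  have hη : 0 < ε / (n + 1) := by positivity
  obtain ⟨w, hw, hFw, hvw⟩ := kerApprox_of_ker hF hvmeas hvL hvker (√(ε / (n + 1)))
    (Real.sqrt_pos.2 hη)
  refine ⟨w, hw, hFw, ?_⟩
  have hi : ∀ i : Fin n, ∫⁻ z in Icc (0:ℝ) 1 ×ˢ Icc (0:ℝ) 1, (‖v z i - w z i‖₊ : ℝ≥0∞) ^ 2 ≤
      ENNReal.ofReal (ε / (n + 1)) := fun i => by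
    calc _ ≤ ∫⁻ z, ‖(v - w) z‖ₑ ^ 2 ∂squareVol := by
          refine lintegral_mono fun z => pow_le_pow_left' ?_ 2
          exact ENNReal.coe_le_coe.2 (nnnorm_le_pi_nnnorm ((v - w) z) i)
      _ = eLpNorm (v - w) 2 squareVol ^ 2 := (eLpNorm_two_sq_eq_lintegral _ _).symm
      _ ≤ ENNReal.ofReal (√(ε / (n + 1))) ^ 2 := pow_le_pow_left' hvw 2
      _ = ENNReal.ofReal (ε / (n + 1)) := by
          rw [← ENNReal.ofReal_pow (Real.sqrt_nonneg _), Real.sq_sqrt hη.le]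
  refine (Finset.sum_le_sum fun i _ => hi i).trans_lt ?_
  rw [← ENNReal.ofReal_sum_of_nonneg fun _ _ => hη.le]
  refine (ENNReal.ofReal_lt_ofReal_iff hε).2 ?_
  rw [Finset.sum_const, Finset.card_univ, Fintype.card_fin, nsmul_eq_mul, mul_div_assoc',
    div_lt_iff₀ (by positivity)]
  nlinarith
end
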